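/- Every finite critical (P5, banner)-free graph is 3K1-free. -/

import Mathlib

open SimpleGraph

/-- `G` is `H`-free: no induced subgraph of `G` is isomorphic to `H`. -/
def IndFree {α β : Type*} (H : SimpleGraph α) (G : SimpleGraph β) : Prop :=
  ∀ s : Set β, ¬ Nonempty (H ≃g G.induce s)

/-- The banner: a 4-cycle `0-1-2-3-0` together with a pendant vertex `4` adjacent to `0`. -/
def banner : SimpleGraph (Fin 5) :=
  SimpleGraph.fromEdgeSet {s(0,1), s(1,2), s(2,3), s(3,0), s(0,4)}

/-- The co-banner: the complement of the banner. -/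
def coBanner : SimpleGraph (Fin 5) := bannerᶜ

/-- `2K₂`: the disjoint union of two edges. -/
def twoK2 : SimpleGraph (Fin 4) := SimpleGraph.fromEdgeSet {s(0,1), s(2,3)}

/-- `3K₁`: three pairwise nonadjacent vertices. -/
def threeK1 : SimpleGraph (Fin 3) := ⊥

/-- The 5-wheel: a 5-cycle `0-1-2-3-4-0` plus a hub `5` adjacent to all cycle vertices. -/
def wheel5 : SimpleGraph (Fin 6) :=
  SimpleGraph.fromEdgeSet
    {s(0,1), s(1,2), s(2,3), s(3,4), s(4,0), s(5,0), s(5,1), s(5,2), s(5,3), s(5,4)}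

/-- A nonempty set `M` is a module if every vertex outside `M` is adjacent to all
or to none of the vertices of `M`. -/
def IsModule {V : Type*} (G : SimpleGraph V) (M : Set V) : Prop :=
  M.Nonempty ∧ ∀ v ∉ M, (∀ u ∈ M, G.Adj v u) ∨ (∀ u ∈ M, ¬ G.Adj v u)

/-- `X` is a clique-separator of modules in `G`. -/
def IsCliqueSeparatorOfModules {V : Type*} (G : SimpleGraph V) (X : Set V) : Prop :=
  (∃ (k : ℕ) (Xs : Fin k → Set V),
      (∀ i, IsModule G (Xs i)) ∧
      (∀ i j, i ≠ j → Disjoint (Xs i) (Xs j)) ∧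
      (∀ i j, i ≠ j → ∀ u ∈ Xs i, ∀ v ∈ Xs j, G.Adj u v) ∧
      X = ⋃ i, Xs i) ∧
  (∃ A B : Set V, A ∪ B = Set.univ ∧ (A \ B).Nonempty ∧ (B \ A).Nonempty ∧
      (∀ a ∈ A \ B, ∀ b ∈ B \ A, ¬ G.Adj a b) ∧ A ∩ B = X)

/-- A graph is prime if it has no homogeneous set,
i.e. no module `M` with `1 < |M| < |V(G)|`. -/
def IsPrime {V : Type*} (G : SimpleGraph V) : Prop :=
  ¬ ∃ M : Set V, IsModule G M ∧ 1 < M.ncard ∧ M.ncard < Nat.card V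

/-- A nonempty graph is critical if deleting any vertex decreases the chromatic number. -/
def IsCritical {V : Type*} (G : SimpleGraph V) : Prop :=
  Nonempty V ∧ ∀ v : V, (G.induce {u | u ≠ v}).chromaticNumber < G.chromaticNumber

/-- `G` is a `non-empty, 2K₁-free'-expansion of `G'`: the fibres of `f` partition `V(G)`
into nonempty cliques, with complete/empty bipartite connections according to `G'`. -/
def IsExpansionOf {V W : Type*} (G : SimpleGraph V) (G' : SimpleGraph W) : Prop :=
  ∃ f : V → W, Function.Surjective f ∧
    (∀ u v, u ≠ v → f u = f v → G.Adj u v) ∧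
    (∀ u v, f u ≠ f v → (G.Adj u v ↔ G'.Adj (f u) (f v)))

/-- The weighted chromatic number `χ_q(G)`: the least `k` such that every vertex `v`
can be assigned a set of `q v` colours from `{1,…,k}` with disjoint sets on adjacent
vertices. -/
noncomputable def wChromaticNumber {V : Type*} (G : SimpleGraph V) (q : V → ℕ) : ℕ :=
  sInf {k | ∃ L : V → Finset (Fin k), (∀ v, (L v).card = q v) ∧
    ∀ ⦃u v⦄, G.Adj u v → Disjoint (L u) (L v)}

/-- The weighted clique number `ω_q(G)`: the maximum total weight of a clique. -/
noncomputable def wCliqueNum {V : Type*} (G : SimpleGraph V) (q : V → ℕ) : ℕ :=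
  sSup {m | ∃ s : Finset V, G.IsClique (s : Set V) ∧ m = ∑ v ∈ s, q v}

/-- `Q(F)`: a path `u₁u₂u₃u₄` whose third vertex `u₃` has been replaced by a copy of `F`,
each of whose vertices is adjacent to both `u₂` and `u₄`. Here `inr 0 = u₁`, `inr 1 = u₂`,
`inr 2 = u₄`, and `inl w` are the vertices of the copy of `F`. -/
def QGraph {W : Type*} (F : SimpleGraph W) : SimpleGraph (W ⊕ Fin 3) :=
  SimpleGraph.fromRel (fun a b =>
    (∃ w w', a = Sum.inl w ∧ b = Sum.inl w' ∧ F.Adj w w') ∨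
    (a = Sum.inr 0 ∧ b = Sum.inr 1) ∨
    (∃ w, a = Sum.inl w ∧ (b = Sum.inr 1 ∨ b = Sum.inr 2)))

/-- The join of two graphs: all edges of both graphs plus all edges in between. -/
def joinGraph {α β : Type*} (G₁ : SimpleGraph α) (G₂ : SimpleGraph β) :
    SimpleGraph (α ⊕ β) :=
  SimpleGraph.fromRel (fun a b =>
    (∃ u v, a = Sum.inl u ∧ b = Sum.inl v ∧ G₁.Adj u v) ∨
    (∃ u v, a = Sum.inr u ∧ b = Sum.inr v ∧ G₂.Adj u v) ∨
    (∃ u v, a = Sum.inl u ∧ b = Sum.inr v))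

/-- `H` has a spanning complete bipartite subgraph. -/
def HasSpanningCompleteBipartite {α : Type*} (H : SimpleGraph α) : Prop :=
  ∃ A B : Set α, A.Nonempty ∧ B.Nonempty ∧ Disjoint A B ∧ A ∪ B = Set.univ ∧
    ∀ a ∈ A, ∀ b ∈ B, H.Adj a b

/-- `G'` is a `q`-expansion of `G`: each vertex `u` of `G` is replaced by a clique on
`q u` vertices, joined completely or not at all according to adjacency in `G`. -/
def IsWeightedExpansion {V' V : Type*} (G' : SimpleGraph V') (G : SimpleGraph V)
    (q : V → ℕ) : Prop :=
  ∃ f : V' → V,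
    (∀ v : V, Nat.card (f ⁻¹' {v}) = q v) ∧
    (∀ a b : V', a ≠ b → f a = f b → G'.Adj a b) ∧
    (∀ a b : V', f a ≠ f b → (G'.Adj a b ↔ G.Adj (f a) (f b)))

/-- `q` is `⊲`-minimal: no weight function pointwise at most `q` with strictly smaller
total weight has the same weighted chromatic number. -/
def IsTriMinimal {V : Type*} [Fintype V] (G : SimpleGraph V) (q : V → ℕ) : Prop :=
  ¬ ∃ q' : V → ℕ, (∀ v, q' v ≤ q v) ∧ (∑ v, q' v) < (∑ v, q v) ∧
      wChromaticNumber G q' = wChromaticNumber G q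

/-- An adjacency-preserving and -reflecting injection exhibits an induced copy. -/
theorem IndFree.not_embedding {α β : Type*} {H : SimpleGraph α} {G : SimpleGraph β}
    (h : IndFree H G) (f : H ↪g G) : False :=
  h (Set.range f) ⟨Equiv.ofInjective f f.injective, fun {_ _} => f.map_adj_iff⟩

theorem pathGraph_five_free {V : Type*} {G : SimpleGraph V} (h : IndFree (pathGraph 5) G)
    {a b c d e : V} (hab : G.Adj a b) (hbc : G.Adj b c) (hcd : G.Adj c d) (hde : G.Adj d e)
    (hac : ¬ G.Adj a c) (had : ¬ G.Adj a d) (hae : ¬ G.Adj a e) (hbd : ¬ G.Adj b d)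
    (hbe : ¬ G.Adj b e) (hce : ¬ G.Adj c e) : False := by
  have hadj : ∀ i j, G.Adj (![a, b, c, d, e] i) (![a, b, c, d, e] j) ↔
      (pathGraph 5).Adj i j := by
    intro i j
    fin_cases i <;> fin_cases j <;>
      simp [pathGraph_adj, G.adj_comm, *]
  have hinj : Function.Injective ![a, b, c, d, e] := by
    intro i j hij
    have hrow : ∀ k, (pathGraph 5).Adj i k ↔ (pathGraph 5).Adj j k := fun k => by
      rw [← hadj, ← hadj, hij]
    clear hij
    simp only [pathGraph_adj] at hrow
    revert i j
    decide
  exact h.not_embedding ⟨⟨_, hinj⟩, fun {i j} => hadj i j⟩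

theorem banner_free {V : Type*} {G : SimpleGraph V} (h : IndFree banner G)
    {a b c d p : V} (hab : G.Adj a b) (hbc : G.Adj b c) (hcd : G.Adj c d) (hda : G.Adj d a)
    (hap : G.Adj a p) (hac : ¬ G.Adj a c) (hbd : ¬ G.Adj b d) (hac' : a ≠ c) (hbd' : b ≠ d)
    (hbp : ¬ G.Adj b p) (hcp : ¬ G.Adj c p) (hdp : ¬ G.Adj d p) : False := by
  have hadj : ∀ i j, G.Adj (![a, b, c, d, p] i) (![a, b, c, d, p] j) ↔ banner.Adj i j := by
    have had := hda.symm
    intro i j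
    fin_cases i <;> fin_cases j <;>
      simp [banner, G.adj_comm, *]
  have hinj : Function.Injective ![a, b, c, d, p] := by
    have := hab.ne
    have := hbc.ne
    have := hcd.ne
    have := hda.ne
    have := hap.ne
    have : b ≠ p := fun e => hcp (e ▸ hbc.symm)
    have : c ≠ p := fun e => hbp (e ▸ hbc)
    have : d ≠ p := fun e => hcp (e ▸ hcd)
    intro i j hij
    fin_cases i <;> fin_cases j <;> simp_all
  exact h.not_embedding ⟨⟨_, hinj⟩, fun {i j} => hadj i j⟩

/-- The component of `t` in the graph obtained by deleting the closed neighbourhood of `s`. -/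
def coComponent {V : Type*} (G : SimpleGraph V) (s t : V) : Set V :=
  {v | Relation.ReflTransGen (fun a b => G.Adj a b ∧ b ≠ s ∧ ¬ G.Adj s b) t v}

/-- The vertices outside `C` with a neighbour in `C`. -/
def outerBoundary {V : Type*} (G : SimpleGraph V) (C : Set V) : Set V :=
  {x | x ∉ C ∧ ∃ c ∈ C, G.Adj x c}

section Component

variable {V : Type*} {G : SimpleGraph V} {s t u : V}

theorem mem_coComponent_self : t ∈ coComponent G s t := Relation.ReflTransGen.refl

theorem coComponent_not_adj (hne : t ≠ s) (hst : ¬ G.Adj s t) {v : V}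
    (hv : v ∈ coComponent G s t) : v ≠ s ∧ ¬ G.Adj s v := by
  cases hv with
  | refl => exact ⟨hne, hst⟩
  | tail _ h => exact h.2

theorem coComponent_closed {v w : V} (hv : v ∈ coComponent G s t) (hvw : G.Adj v w)
    (hw : w ≠ s) (hsw : ¬ G.Adj s w) : w ∈ coComponent G s t :=
  Relation.ReflTransGen.tail hv ⟨hvw, hw, hsw⟩

theorem coComponent_induction {P : V → Prop}
    (hP : ∀ a ∈ coComponent G s t, ∀ b ∈ coComponent G s t, G.Adj a b → P a → P b)
    {p q : V} (hp : p ∈ coComponent G s t) (hPp : P p) (hq : q ∈ coComponent G s t) : P q := by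
  have key : ∀ v ∈ coComponent G s t, (P t ↔ P v) := by
    intro v hv
    induction hv with
    | refl => rfl
    | tail h₁ h₂ ih =>
      have h₃ := coComponent_closed h₁ h₂.1 h₂.2.1 h₂.2.2
      exact ih.trans ⟨hP _ h₁ _ h₃ h₂.1, hP _ h₃ _ h₁ h₂.1.symm⟩
  exact (key q hq).1 ((key p hp).2 hPp)

theorem adj_of_mem_outerBoundary (hne : t ≠ s) (hst : ¬ G.Adj s t) {x : V}
    (hx : x ∈ outerBoundary G (coComponent G s t)) : G.Adj s x := by
  obtain ⟨hxC, c, hc, hxc⟩ := hx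
  by_contra hsx
  have hcs := coComponent_not_adj hne hst hc
  refine hxC (coComponent_closed hc hxc.symm ?_ hsx)
  rintro rfl
  exact hcs.2 hxc

end Component

/-- A boundary vertex `y` of the component of `t`, nonadjacent to another boundary vertex, is
complete to the component as soon as it has a neighbour not dominating the component. -/
theorem complete_of_adj_nondominating {V : Type*} {G : SimpleGraph V}
    (hP5 : IndFree (pathGraph 5) G) (hbanner : IndFree banner G) {s t : V}
    (hne : t ≠ s) (hst : ¬ G.Adj s t) {x y : V}
    (hx : x ∈ outerBoundary G (coComponent G s t))
    (hy : y ∈ outerBoundary G (coComponent G s t)) (hxy : x ≠ y) (hxy' : ¬ G.Adj x y)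
    {b b' : V} (hb : b ∈ coComponent G s t) (hb' : b' ∈ coComponent G s t) (hbb' : b ≠ b')
    (hnbb' : ¬ G.Adj b b') (hyb : G.Adj y b) {c : V} (hc : c ∈ coComponent G s t) :
    G.Adj y c := by
  have hsx := adj_of_mem_outerBoundary hne hst hx
  have hsy := adj_of_mem_outerBoundary hne hst hy
  have hsC : ∀ c ∈ coComponent G s t, ¬ G.Adj s c ∧ ¬ G.Adj c s := fun c hc =>
    have h := (coComponent_not_adj hne hst hc).2
    ⟨h, fun h' => h h'.symm⟩
  have hsC' : ∀ c ∈ coComponent G s t, c ≠ s :=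
    fun c hc => (coComponent_not_adj hne hst hc).1
  obtain ⟨-, cx, hcx, hxcx⟩ := hx
  have hcov : ∀ c ∈ coComponent G s t, G.Adj x c ∨ G.Adj y c := by
    intro c hc
    refine coComponent_induction (P := fun c => G.Adj x c ∨ G.Adj y c) ?_ hcx (Or.inl hxcx) hc
    intro a ha b hb hab hxya
    by_contra! hn
    by_cases hxa : G.Adj x a
    · by_cases hya : G.Adj y a
      · exact banner_free hbanner (a := a) (b := x) (c := s) (d := y) (p := b)
          hxa.symm hsx.symm hsy hya hab (hsC a ha).2 hxy' (hsC' a ha) hxy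
          hn.1 (hsC b hb).1 hn.2
      · exact pathGraph_five_free hP5 hab.symm hxa.symm hsx.symm hsy (fun h => hn.1 h.symm)
          (hsC b hb).2 (fun h => hn.2 h.symm) (hsC a ha).2
          (fun h => hya h.symm) hxy'
    · have hya := hxya.resolve_left hxa
      exact pathGraph_five_free hP5 hab.symm hya.symm hsy.symm hsx (fun h => hn.2 h.symm)
          (hsC b hb).2 (fun h => hn.1 h.symm) (hsC a ha).2
          (fun h => hxa h.symm) (fun h => hxy' h.symm)
  have hyx' : ¬ G.Adj y x := fun h => hxy' h.symm
  have hpriv : ∀ p ∈ coComponent G s t, ∀ q ∈ coComponent G s t,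
      G.Adj x p → ¬ G.Adj y p → G.Adj y q → ¬ G.Adj x q → G.Adj p q := by
    intro p hp q hq h₁ h₂ h₃ h₄
    by_contra hpq
    exact pathGraph_five_free hP5 h₁.symm hsx.symm hsy h₃ (hsC p hp).2
      (fun h => h₂ h.symm) hpq hxy' h₄ (hsC q hq).1
  have hcommon : ∀ p ∈ coComponent G s t, ∀ q ∈ coComponent G s t,
      G.Adj x p → G.Adj y p → (G.Adj x q ∧ ¬ G.Adj y q ∨ ¬ G.Adj x q ∧ G.Adj y q) →
      G.Adj p q := by
    intro p hp q hq h₁ h₂ h₃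
    by_contra hpq
    rcases h₃ with ⟨h₃, h₄⟩ | ⟨h₃, h₄⟩
    · exact banner_free hbanner hsx.symm hsy h₂ h₁.symm h₃ hxy' (hsC p hp).1 hxy
        (hsC' p hp).symm (hsC q hq).1 h₄ hpq
    · exact banner_free hbanner hsy.symm hsx h₁ h₂.symm h₄ hyx' (hsC p hp).1 hxy.symm
        (hsC' p hp).symm (hsC q hq).1 h₃ hpq
  by_contra hyc
  have hxc := (hcov c hc).resolve_right hyc
  have hcy : y ≠ c := fun h => (hsC c hc).1 (h ▸ hsy)
  have hyb' : G.Adj y b' := by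
    by_contra hyb'
    have hxb' := (hcov b' hb').resolve_right hyb'
    by_cases hxb : G.Adj x b
    · exact hnbb' (hcommon b hb b' hb' hxb hyb (Or.inl ⟨hxb', hyb'⟩))
    · exact hnbb' (hpriv b' hb' b hb hxb' hyb' hyb hxb).symm
  have hadj : ∀ p ∈ coComponent G s t, G.Adj y p → G.Adj p c := by
    intro p hp hyp
    by_cases hxp : G.Adj x p
    · exact hcommon p hp c hc hxp hyp (Or.inl ⟨hxc, hyc⟩)
    · exact (hpriv c hc p hp hxc hyc hyp hxp).symm
  exact banner_free hbanner hyb (hadj b hb hyb) (hadj b' hb' hyb').symm hyb'.symm hsy.symm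
    hyc hnbb' hcy hbb' (hsC b hb).2 (hsC c hc).2 (hsC b' hb').2

section Colouring

variable {V : Type*} {G : SimpleGraph V}

/-- A colouring proper on `S ⊇ X` can be modified so that on each part of `X` it factors
through a colouring `e` of `X` that uses no more colours on any part. -/
theorem exists_recolouring {ι : Type*} {k : ℕ} {X S : Set V} (hXS : X ⊆ S) {κ : V → ι}
    (hκ : ∀ x ∈ X, ∀ y ∈ X, κ x ≠ κ y → G.Adj x y)
    (hmod : ∀ x ∈ X, ∀ y ∈ X, κ x = κ y → ∀ v ∉ X, G.Adj v x → G.Adj v y)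
    {c e : V → Fin k} (hc : ∀ u ∈ S, ∀ v ∈ S, G.Adj u v → c u ≠ c v)
    (he : ∀ x ∈ X, ∀ y ∈ X, κ x = κ y → G.Adj x y → e x ≠ e y)
    (hle : ∀ m, (e '' {x ∈ X | κ x = m}).encard ≤ (c '' {x ∈ X | κ x = m}).encard) :
    ∃ (f : ι × Fin k → Fin k) (c' : V → Fin k),
      Set.InjOn f ((fun x => (κ x, e x)) '' X) ∧ (∀ x ∈ X, c' x = f (κ x, e x)) ∧
      ∀ u ∈ S, ∀ v ∈ S, G.Adj u v → c' u ≠ c' v := by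
  classical
  have hg : ∀ m, ∃ g : Fin k → Fin k, Set.MapsTo g (e '' {x ∈ X | κ x = m})
      (c '' {x ∈ X | κ x = m}) ∧ Set.InjOn g (e '' {x ∈ X | κ x = m}) := by
    intro m
    rcases Set.eq_empty_or_nonempty (e '' {x ∈ X | κ x = m}) with h | ⟨i, -⟩
    · exact ⟨id, by simp [h, Set.MapsTo], by simp [h]⟩
    · have : Nonempty (Fin k) := ⟨i⟩
      obtain ⟨g, hg₁, hg₂⟩ := (Set.toFinite _).exists_injOn_of_encard_le (hle m)
      exact ⟨g, hg₁, hg₂⟩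
  choose g hmaps hinj using hg
  have hval : ∀ x ∈ X, ∃ x' ∈ X, κ x' = κ x ∧ c x' = g (κ x) (e x) := by
    intro x hx
    obtain ⟨x', ⟨hx', hκ'⟩, h⟩ := hmaps (κ x) ⟨x, ⟨hx, rfl⟩, rfl⟩
    exact ⟨x', hx', hκ', h⟩
  have hinjX : ∀ x ∈ X, ∀ y ∈ X, g (κ x) (e x) = g (κ y) (e y) → κ x = κ y ∧ e x = e y := by
    intro x hx y hy h
    have hxy : κ x = κ y := by
      by_contra hxy
      obtain ⟨x', hx', hκx, hcx⟩ := hval x hx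
      obtain ⟨y', hy', hκy, hcy⟩ := hval y hy
      exact hc x' (hXS hx') y' (hXS hy') (hκ x' hx' y' hy' (by rwa [hκx, hκy]))
        (by rw [hcx, hcy, h])
    refine ⟨hxy, ?_⟩
    rw [← hxy] at h
    exact hinj (κ x) ⟨x, ⟨hx, rfl⟩, rfl⟩ ⟨y, ⟨hy, hxy.symm⟩, rfl⟩ h
  have hout : ∀ x ∈ X, ∀ v ∈ S, v ∉ X → G.Adj v x → c v ≠ g (κ x) (e x) := by
    intro x hx v hv hvX hvx h
    obtain ⟨x', hx', hκx, hcx⟩ := hval x hx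
    exact hc v hv x' (hXS hx') (hmod x hx x' hx' hκx.symm v hvX hvx) (h.trans hcx.symm)
  refine ⟨fun p => g p.1 p.2, fun v => if v ∈ X then g (κ v) (e v) else c v, ?_, ?_, ?_⟩
  · rintro _ ⟨x, hx, rfl⟩ _ ⟨y, hy, rfl⟩ h
    obtain ⟨h₁, h₂⟩ := hinjX x hx y hy h
    exact Prod.ext h₁ h₂
  · intro x hx
    simp [hx]
  · intro u hu v hv huv
    by_cases huX : u ∈ X <;> by_cases hvX : v ∈ X <;> simp only [huX, hvX, if_true, if_false]
    · intro h
      obtain ⟨h₁, h₂⟩ := hinjX u huX v hvX h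
      exact he u huX v hvX h₁ huv h₂
    · exact (hout u huX v hv hvX huv.symm).symm
    · exact hout v hvX u hu huX huv
    · exact hc u hu v hv huv

/-- Two injections from a set into `Fin k` differ by a permutation. -/
theorem exists_perm_of_injOn {α : Type*} {k : ℕ} {T : Set α} {f g : α → Fin k}
    (hf : Set.InjOn f T) (hg : Set.InjOn g T) :
    ∃ σ : Equiv.Perm (Fin k), ∀ a ∈ T, σ (f a) = g a := by
  classical
  let e : {i // i ∈ f '' T} ≃ {i // i ∈ g '' T} :=
    (Equiv.Set.imageOfInjOn f T hf).symm.trans (Equiv.Set.imageOfInjOn g T hg)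
  refine ⟨e.extendSubtype, fun a ha => ?_⟩
  rw [e.extendSubtype_apply_of_mem (f a) ⟨a, ha, rfl⟩]
  have : (Equiv.Set.imageOfInjOn f T hf).symm ⟨f a, a, ha, rfl⟩ = ⟨a, ha⟩ := by
    rw [Equiv.symm_apply_eq]; rfl
  change ((Equiv.Set.imageOfInjOn g T hg)
    ((Equiv.Set.imageOfInjOn f T hf).symm ⟨f a, a, ha, rfl⟩) : Fin k) = g a
  rw [this]
  rfl

/-- Colourings of the two sides of a separator can be merged when the co-components of the
separator are modules. -/
theorem colorable_of_outerBoundary_modules {k : ℕ} {D : Set V}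
    (hmod : ∀ x ∈ outerBoundary G D, ∀ y ∈ outerBoundary G D, ¬ G.Adj x y →
      ∀ v ∉ outerBoundary G D, G.Adj v x → G.Adj v y)
    {c₁ c₂ : V → Fin k}
    (hc₁ : ∀ u ∈ D ∪ outerBoundary G D, ∀ v ∈ D ∪ outerBoundary G D, G.Adj u v → c₁ u ≠ c₁ v)
    (hc₂ : ∀ u ∈ Dᶜ, ∀ v ∈ Dᶜ, G.Adj u v → c₂ u ≠ c₂ v) : G.Colorable k := by
  classical
  set X := outerBoundary G D
  have hX₁ : X ⊆ D ∪ X := Set.subset_union_right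
  have hX₂ : X ⊆ Dᶜ := fun x hx => hx.1
  let κ : V → Quot (fun a b => a ∈ X ∧ b ∈ X ∧ ¬ G.Adj a b) := Quot.mk _
  have hκ : ∀ x ∈ X, ∀ y ∈ X, κ x ≠ κ y → G.Adj x y := by
    intro x hx y hy h
    by_contra hxy
    exact h (Quot.sound ⟨hx, hy, hxy⟩)
  have hκmod : ∀ x ∈ X, ∀ y ∈ X, κ x = κ y → ∀ v ∉ X, G.Adj v x → G.Adj v y := by
    intro x _ y _ h v hv hvx
    have := congrArg (Quot.lift (fun a => G.Adj v a) (fun a b hab => propext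
      ⟨hmod a hab.1 b hab.2.1 hab.2.2 v hv,
        hmod b hab.2.1 a hab.1 (fun h => hab.2.2 h.symm) v hv⟩)) h
    exact this.mp hvx
  let P : Quot (fun a b => a ∈ X ∧ b ∈ X ∧ ¬ G.Adj a b) → Prop := fun m =>
    (c₁ '' {x ∈ X | κ x = m}).encard ≤ (c₂ '' {x ∈ X | κ x = m}).encard
  let e : V → Fin k := fun x => if P (κ x) then c₁ x else c₂ x
  have heq : ∀ m, e '' {x ∈ X | κ x = m} =
      if P m then c₁ '' {x ∈ X | κ x = m} else c₂ '' {x ∈ X | κ x = m} := by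
    intro m
    have : ∀ x ∈ {x ∈ X | κ x = m}, e x = if P m then c₁ x else c₂ x := by
      rintro x ⟨-, rfl⟩; rfl
    rw [Set.image_congr this]
    split_ifs <;> rfl
  have he : ∀ x ∈ X, ∀ y ∈ X, κ x = κ y → G.Adj x y → e x ≠ e y := by
    intro x hx y hy h hxy
    simp only [e, ← h]
    split_ifs
    · exact hc₁ x (hX₁ hx) y (hX₁ hy) hxy
    · exact hc₂ x (hX₂ hx) y (hX₂ hy) hxy
  obtain ⟨f₁, d₁, hf₁, hd₁, hp₁⟩ := exists_recolouring hX₁ hκ hκmod hc₁ he (fun m => by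
    rw [heq]
    split_ifs with h
    · exact le_rfl
    · exact (not_le.1 h).le)
  obtain ⟨f₂, d₂, hf₂, hd₂, hp₂⟩ := exists_recolouring hX₂ hκ hκmod hc₂ he (fun m => by
    rw [heq]
    split_ifs with h
    · exact h
    · exact le_rfl)
  obtain ⟨σ, hσ⟩ := exists_perm_of_injOn hf₁ hf₂
  have hglue : ∀ x ∈ X, σ (d₁ x) = d₂ x := by
    intro x hx
    rw [hd₁ x hx, hd₂ x hx]
    exact hσ _ ⟨x, hx, rfl⟩
  have hcross : ∀ u ∈ D, ∀ v ∉ D, G.Adj u v → σ (d₁ u) ≠ d₂ v := by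
    intro u hu v hv huv
    have hvX : v ∈ X := ⟨hv, u, hu, huv.symm⟩
    rw [← hglue v hvX]
    exact fun h => hp₁ u (Or.inl hu) v (Or.inr hvX) huv (σ.injective h)
  refine ⟨Coloring.mk (fun v => if v ∈ D then σ (d₁ v) else d₂ v) ?_⟩
  intro u v huv
  by_cases hu : u ∈ D <;> by_cases hv : v ∈ D <;> simp only [hu, hv, if_true, if_false]
  · exact fun h => hp₁ u (Or.inl hu) v (Or.inl hv) huv (σ.injective h)
  · exact hcross u hu v hv huv
  · exact (hcross v hv u hu huv.symm).symm
  · exact hp₂ u hu v hv huv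

theorem IsCritical.exists_not_colorable [Finite V] (hcrit : IsCritical G) :
    ∃ k : ℕ, ¬ G.Colorable k ∧ ∀ v, (G.induce {u | u ≠ v}).Colorable k := by
  obtain ⟨⟨v₀⟩, hcrit⟩ := hcrit
  obtain ⟨m, hm⟩ := ENat.ne_top_iff_exists.1
    (chromaticNumber_ne_top_iff_exists.2 ⟨_, G.colorable_chromaticNumber_of_fintype⟩)
  rw [← hm] at hcrit
  obtain _ | k := m
  · exact absurd (hcrit v₀) (by simp)
  · refine ⟨k, fun h => ?_, fun v => ?_⟩
    · have := h.chromaticNumber_le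
      rw [← hm] at this
      exact absurd (ENat.natCast_le_natCast.1 this) (by omega)
    · rw [← chromaticNumber_le_iff_colorable]
      exact (ENat.lt_add_one_iff (ENat.natCast_ne_top k)).1 (by exact_mod_cast hcrit v)

theorem exists_colouring_off {k : ℕ} {v w : V} (hwv : w ≠ v)
    (h : (G.induce {u | u ≠ v}).Colorable k) :
    ∃ c : V → Fin k, ∀ a, a ≠ v → ∀ b, b ≠ v → G.Adj a b → c a ≠ c b := by
  classical
  obtain ⟨c⟩ := h
  refine ⟨fun a => if h : a ≠ v then c ⟨a, h⟩ else c ⟨w, hwv⟩, fun a ha b hb hab => ?_⟩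
  simp only [ha, hb, ne_eq, not_false_eq_true, dite_true]
  exact c.valid (by simpa using hab)

/-- A finite critical graph has no separator whose co-components are modules. -/
theorem IsCritical.false_of_modules [Finite V] (hcrit : IsCritical G) {D : Set V}
    {r s : V} (hr : r ∈ D) (hs : s ∉ D) (hs' : s ∉ outerBoundary G D)
    (hmod : ∀ x ∈ outerBoundary G D, ∀ y ∈ outerBoundary G D, ¬ G.Adj x y →
      ∀ v ∉ outerBoundary G D, G.Adj v x → G.Adj v y) : False := by
  obtain ⟨k, hk, hcol⟩ := hcrit.exists_not_colorable
  have hsr : s ≠ r := fun h => hs (h ▸ hr)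
  obtain ⟨c₁, hc₁⟩ := exists_colouring_off hsr.symm (hcol s)
  obtain ⟨c₂, hc₂⟩ := exists_colouring_off hsr (hcol r)
  exact hk <| colorable_of_outerBoundary_modules hmod (c₁ := c₁) (c₂ := c₂)
    (fun u hu v hv => hc₁ u (by rintro rfl; exact hu.elim hs hs') v
      (by rintro rfl; exact hv.elim hs hs'))
    (fun u hu v hv => hc₂ u (by rintro rfl; exact hu hr) v (by rintro rfl; exact hv hr))

end Colouring

section Structure

variable {V : Type*} {G : SimpleGraph V}

/-- In a critical graph every component of the complement of a closed neighbourhood is a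
clique. -/
theorem IsCritical.coComponent_clique [Finite V] (hcrit : IsCritical G)
    (hP5 : IndFree (pathGraph 5) G) (hbanner : IndFree banner G) {s t : V}
    (hne : t ≠ s) (hst : ¬ G.Adj s t) {p q : V} (hp : p ∈ coComponent G s t)
    (hq : q ∈ coComponent G s t) (hpq : p ≠ q) : G.Adj p q := by
  by_contra hnpq
  have hsC : ∀ c ∈ coComponent G s t, ¬ G.Adj s c :=
    fun c hc => (coComponent_not_adj hne hst hc).2
  have hsC' : ∀ c ∈ coComponent G s t, c ≠ s :=
    fun c hc => (coComponent_not_adj hne hst hc).1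
  set C := coComponent G s t
  set L : Set V := {c | c ∈ C ∧ ∃ c' ∈ C, c ≠ c' ∧ ¬ G.Adj c c'}
  have hpL : p ∈ L := ⟨hp, q, hq, hpq, hnpq⟩
  have hqL : q ∈ L := ⟨hq, p, hp, hpq.symm, fun h => hnpq h.symm⟩
  have hdom : ∀ x ∈ C, x ∉ L → ∀ c ∈ C, x ≠ c → G.Adj x c := by
    intro x hx hxL c hc hxc
    by_contra h
    exact hxL ⟨hx, c, hc, hxc, h⟩
  have hout : ∀ x ∈ outerBoundary G L, x ∉ C → x ∈ outerBoundary G C := by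
    rintro x ⟨-, l, hl, hxl⟩ hx
    exact ⟨hx, l, hl.1, hxl⟩
  have hjoin : ∀ x ∈ outerBoundary G L, x ∈ C → ∀ w ∈ outerBoundary G L, w ∉ C →
      G.Adj x w := by
    intro x hx hxC w hw hwC
    by_contra hxw
    have hsw := adj_of_mem_outerBoundary hne hst (hout w hw hwC)
    obtain ⟨-, l, hl, hwl⟩ := hw
    obtain ⟨hlC, l', hl', hll', hnll'⟩ := hl
    have hxL := hx.1
    have hxl : G.Adj x l := hdom x hxC hxL l hlC (by rintro rfl; exact hxw hwl.symm)
    have hxl' : G.Adj x l' := hdom x hxC hxL l' hl' (by rintro rfl; exact hnll' hxl.symm)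
    by_cases hwl' : G.Adj w l'
    · exact banner_free hbanner hwl hxl.symm hxl' hwl'.symm hsw.symm (fun h => hxw h.symm)
        hnll' (fun h => hwC (h ▸ hxC)) hll' (fun h => hsC l hlC h.symm)
        (fun h => hsC x hxC h.symm) (fun h => hsC l' hl' h.symm)
    · exact pathGraph_five_free hP5 hsw hwl hxl.symm hxl' (hsC l hlC) (hsC x hxC)
        (hsC l' hl') (fun h => hxw h.symm) hwl' hnll'
  refine hcrit.false_of_modules hpL (fun h => hsC' s h.1 rfl)
    (fun ⟨_, c, hc, h⟩ => hsC c hc.1 h) ?_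
  intro x hx y hy hxy v hv hvx
  by_cases hxy' : x = y
  · exact hxy' ▸ hvx
  by_cases hxC : x ∈ C <;> by_cases hyC : y ∈ C
  · exact absurd (hdom x hxC hx.1 y hyC hxy') hxy
  · exact absurd (hjoin x hx hxC y hy hyC) hxy
  · exact absurd (hjoin y hy hyC x hx hxC).symm hxy
  · have hyx : ¬ G.Adj y x := fun h => hxy h.symm
    obtain ⟨-, l, ⟨hlC, l', hl', hll', hnll'⟩, hyl⟩ := id hy
    obtain ⟨-, m, ⟨hmC, m', hm', hmm', hnmm'⟩, hxm⟩ := id hx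
    have hyall : ∀ c ∈ C, G.Adj y c := fun c hc =>
      complete_of_adj_nondominating hP5 hbanner hne hst (hout x hx hxC) (hout y hy hyC)
        hxy' hxy hlC hl' hll' hnll' hyl hc
    have hxall : ∀ c ∈ C, G.Adj x c := fun c hc =>
      complete_of_adj_nondominating hP5 hbanner hne hst (hout y hy hyC) (hout x hx hxC)
        (Ne.symm hxy') hyx hmC hm' hmm' hnmm' hxm hc
    by_cases hvC : v ∈ C
    · exact (hyall v hvC).symm
    · have hvL : ∀ l ∈ L, ¬ G.Adj l v := fun l hl h => hv ⟨fun h => hvC h.1, l, hl, h.symm⟩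
      by_contra hvy
      exact banner_free hbanner (hxall p hp) (hyall p hp).symm (hyall q hq) (hxall q hq).symm
        hvx.symm hxy hnpq hxy' hpq (hvL p hpL) (fun h => hvy h.symm) (hvL q hqL)

/-- With clique components, the component of `u` has no boundary outside that of `t`. -/
theorem outerBoundary_subset
    (hcl : ∀ {s t : V}, t ≠ s → ¬ G.Adj s t → ∀ {p q : V}, p ∈ coComponent G s t →
      q ∈ coComponent G s t → p ≠ q → G.Adj p q)
    {s t u : V} (hts : t ≠ s) (hst : ¬ G.Adj s t) (hus : u ≠ s) (hsu : ¬ G.Adj s u)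
    (htC : ∀ c ∈ coComponent G s u, c ∉ coComponent G s t) :
    outerBoundary G (coComponent G s u) ⊆ outerBoundary G (coComponent G s t) := by
  intro x hx
  by_contra hxX
  have hsx := adj_of_mem_outerBoundary hus hsu hx
  have hxC : x ∉ coComponent G s t := fun h => (coComponent_not_adj hts hst h).2 hsx
  have htx : ¬ G.Adj t x := fun h => hxX ⟨hxC, t, mem_coComponent_self, h.symm⟩
  have hxt : x ≠ t := by rintro rfl; exact hxC mem_coComponent_self
  have htE : ∀ c ∈ coComponent G s u, c ≠ t ∧ ¬ G.Adj t c := by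
    intro c hc
    have hc' := coComponent_not_adj hus hsu hc
    refine ⟨?_, fun h => htC c hc (coComponent_closed mem_coComponent_self h hc'.1 hc'.2)⟩
    rintro rfl
    exact htC c hc mem_coComponent_self
  obtain ⟨-, e, he, hxe⟩ := hx
  have hxs : x ∈ coComponent G t s := coComponent_closed mem_coComponent_self hsx hxt htx
  have hes : e ∈ coComponent G t s := coComponent_closed hxs hxe (htE e he).1 (htE e he).2
  have hu : u ∈ coComponent G t s :=
    coComponent_induction (P := (· ∈ coComponent G t s))
      (fun a _ b hb hab ha => coComponent_closed ha hab (htE b hb).1 (htE b hb).2) he hes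
      mem_coComponent_self
  exact hsu (hcl hts.symm (fun h => hst h.symm) mem_coComponent_self hu hus.symm)

/-- Two cliques that both attach to nonadjacent `x` and `y` behave like modules for them. -/
theorem adj_transfer (hP5 : IndFree (pathGraph 5) G) (hbanner : IndFree banner G) {s : V}
    {C E X : Set V}
    (hC : ∀ p ∈ C, ∀ q ∈ C, p ≠ q → G.Adj p q) (hE : ∀ p ∈ E, ∀ q ∈ E, p ≠ q → G.Adj p q)
    (hCE : ∀ p ∈ C, ∀ q ∈ E, ¬ G.Adj p q) (hdisj : ∀ p ∈ C, p ∉ E)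
    (hsC : ∀ c ∈ C, c ≠ s ∧ ¬ G.Adj s c) (hsE : ∀ c ∈ E, c ≠ s ∧ ¬ G.Adj s c)
    (hXC : outerBoundary G C = X) (hXE : outerBoundary G E = X) (hsX : ∀ x ∈ X, G.Adj s x)
    {x y v : V} (hx : x ∈ X) (hy : y ∈ X) (hxy : ¬ G.Adj x y) (hv : v ∉ X)
    (hvx : G.Adj v x) : G.Adj v y := by
  by_cases hne : x = y
  · exact hne ▸ hvx
  have hyx : ¬ G.Adj y x := fun h => hxy h.symm
  have hsx := hsX x hx
  have hsy := hsX y hy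
  have hsame : ∀ c, c ≠ s → ¬ G.Adj s c → G.Adj x c → G.Adj y c → ∀ w, ¬ G.Adj s w →
      ¬ G.Adj c w → (G.Adj x w ↔ G.Adj y w) := by
    intro c hcs hsc hxc hyc w hsw hcw
    constructor <;> intro h <;> by_contra h'
    · exact banner_free hbanner hsx.symm hsy hyc hxc.symm h hxy hsc hne hcs.symm hsw h' hcw
    · exact banner_free hbanner hsy.symm hsx hxc hyc.symm h hyx hsc (Ne.symm hne) hcs.symm
        hsw h' hcw
  obtain ⟨cx, hcx, hxcx⟩ := (hXC.symm ▸ hx : x ∈ outerBoundary G C).2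
  obtain ⟨cy, hcy, hycy⟩ := (hXC.symm ▸ hy : y ∈ outerBoundary G C).2
  obtain ⟨ex, hex, hxex⟩ := (hXE.symm ▸ hx : x ∈ outerBoundary G E).2
  obtain ⟨ey, hey, hyey⟩ := (hXE.symm ▸ hy : y ∈ outerBoundary G E).2
  have hEC : ∀ p ∈ E, ∀ q ∈ C, ¬ G.Adj p q := fun p hp q hq h => hCE q hq p hp h.symm
  have hsameC : ∀ c ∈ C, G.Adj x c → G.Adj y c → ∀ w ∈ E, (G.Adj x w ↔ G.Adj y w) :=
    fun c hc h₁ h₂ w hw => hsame c (hsC c hc).1 (hsC c hc).2 h₁ h₂ w (hsE w hw).2 (hCE c hc w hw)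
  have hsameE : ∀ e ∈ E, G.Adj x e → G.Adj y e → ∀ w ∈ C, (G.Adj x w ↔ G.Adj y w) :=
    fun e he h₁ h₂ w hw => hsame e (hsE e he).1 (hsE e he).2 h₁ h₂ w (hsC w hw).2 (hEC e he w hw)
  obtain ⟨c, hc, hxc, hyc, e, he, hxe, hye⟩ : ∃ c ∈ C, G.Adj x c ∧ G.Adj y c ∧
      ∃ e ∈ E, G.Adj x e ∧ G.Adj y e := by
    by_cases h₁ : G.Adj x cy
    · exact ⟨cy, hcy, h₁, hycy, ex, hex, hxex, (hsameC cy hcy h₁ hycy ex hex).1 hxex⟩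
    by_cases h₂ : G.Adj x ey
    · exact ⟨cx, hcx, hxcx, (hsameE ey hey h₂ hyey cx hcx).1 hxcx, ey, hey, h₂, hyey⟩
    exact (pathGraph_five_free hP5
      (hC cy hcy cx hcx (by rintro rfl; exact h₁ hxcx)) hxcx.symm hxex
      (hE ex hex ey hey (by rintro rfl; exact h₂ hxex)) (fun h => h₁ h.symm) (hCE cy hcy ex hex)
      (hCE cy hcy ey hey) (hCE cx hcx ex hex) (hCE cx hcx ey hey) h₂).elim
  have hall : ∀ (K : Set V), (∀ p ∈ K, ∀ q ∈ K, p ≠ q → G.Adj p q) →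
      (∀ w ∈ K, w ≠ s ∧ ¬ G.Adj s w) → (∀ w ∈ K, (G.Adj x w ↔ G.Adj y w)) →
      ∀ d ∈ K, G.Adj x d → G.Adj y d → ∀ w ∈ K, G.Adj y w := by
    intro K hK hsK hiff d hd hxd hyd w hw
    by_contra hyw
    have hxw : ¬ G.Adj x w := fun h => hyw ((hiff w hw).1 h)
    exact banner_free hbanner hxd.symm hsx.symm hsy hyd
      (hK d hd w hw (by rintro rfl; exact hyw hyd)) (fun h => (hsK d hd).2 h.symm) hxy
      (hsK d hd).1 hne hxw (hsK w hw).2 hyw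
  by_cases hvC : v ∈ C
  · exact (hall C hC hsC (hsameE e he hxe hye) c hc hxc hyc v hvC).symm
  by_cases hvE : v ∈ E
  · exact (hall E hE hsE (hsameC c hc hxc hyc) e he hxe hye v hvE).symm
  by_contra hvy
  have hcv : ¬ G.Adj c v := fun h => hv (hXC ▸ ⟨hvC, c, hc, h.symm⟩)
  have hev : ¬ G.Adj e v := fun h => hv (hXE ▸ ⟨hvE, e, he, h.symm⟩)
  exact banner_free hbanner hxc hyc.symm hye hxe.symm hvx.symm hxy (hCE c hc e he) hne
    (by rintro rfl; exact hdisj c hc he) hcv (fun h => hvy h.symm) hev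

end Structure

/-- Every finite critical `(P₅, banner)`-free graph is `3K₁`-free. -/
theorem stmt5 {V : Type} [Fintype V] (G : SimpleGraph V) (hcrit : IsCritical G)
    (hP5 : IndFree (pathGraph 5) G) (hbanner : IndFree banner G) :
    IndFree threeK1 G := by
  rintro S ⟨f⟩
  have hcl : ∀ {s t : V}, t ≠ s → ¬ G.Adj s t → ∀ {p q : V}, p ∈ coComponent G s t →
      q ∈ coComponent G s t → p ≠ q → G.Adj p q :=
    fun hne hst _ _ hp hq hpq => hcrit.coComponent_clique hP5 hbanner hne hst hp hq hpq
  have hindep : ∀ i j, ¬ G.Adj (f i : V) (f j) := fun i j h => by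
    have := (f.map_adj_iff (v := i) (w := j)).1 h
    simp [threeK1] at this
  have hneq : ∀ i j, i ≠ j → (f i : V) ≠ f j := fun i j hij h =>
    hij (f.injective (Subtype.ext h))
  obtain ⟨s, hs⟩ : ∃ s : V, s = f 0 := ⟨_, rfl⟩
  obtain ⟨t, ht⟩ : ∃ t : V, t = f 1 := ⟨_, rfl⟩
  obtain ⟨u, hu⟩ : ∃ u : V, u = f 2 := ⟨_, rfl⟩
  have hst : ¬ G.Adj s t := by rw [hs, ht]; exact hindep _ _
  have hsu : ¬ G.Adj s u := by rw [hs, hu]; exact hindep _ _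
  have htu : ¬ G.Adj t u := by rw [ht, hu]; exact hindep _ _
  have hts : t ≠ s := by rw [hs, ht]; exact hneq _ _ (by decide)
  have hus : u ≠ s := by rw [hs, hu]; exact hneq _ _ (by decide)
  have htu' : t ≠ u := by rw [ht, hu]; exact hneq _ _ (by decide)
  have huC : u ∉ coComponent G s t := fun h => htu (hcl hts hst mem_coComponent_self h htu')
  have hdisj : ∀ c ∈ coComponent G s u, c ∉ coComponent G s t := fun c hc hc' =>
    huC (coComponent_induction (P := (· ∈ coComponent G s t))
      (fun a _ b hb hab ha => coComponent_closed ha hab (coComponent_not_adj hus hsu hb).1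
        (coComponent_not_adj hus hsu hb).2) hc hc' mem_coComponent_self)
  have hX : outerBoundary G (coComponent G s u) = outerBoundary G (coComponent G s t) :=
    (outerBoundary_subset hcl hts hst hus hsu hdisj).antisymm
      (outerBoundary_subset hcl hus hsu hts hst fun c hc hc' => hdisj c hc' hc)
  refine hcrit.false_of_modules (D := coComponent G s t) (s := s) mem_coComponent_self
    (fun h => (coComponent_not_adj hts hst h).1 rfl)
    (fun h => G.loopless.irrefl s (adj_of_mem_outerBoundary hts hst h)) ?_
  intro x hx y hy hxy v hv hvx
  exact adj_transfer hP5 hbanner (fun _ hp _ hq hpq => hcl hts hst hp hq hpq)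
    (fun _ hp _ hq hpq => hcl hus hsu hp hq hpq)
    (fun p hp q hq h => hdisj q hq (coComponent_closed hp h (coComponent_not_adj hus hsu hq).1
      (coComponent_not_adj hus hsu hq).2))
    (fun p hp hp' => hdisj p hp' hp) (fun _ => coComponent_not_adj hts hst)
    (fun _ => coComponent_not_adj hus hsu) rfl hX (fun _ => adj_of_mem_outerBoundary hts hst)
    hx hy hxy hv hvx
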